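/- arXiv:0708.4244 — 2 statements merged into one kernel-verified Lean document; each statement's English description precedes it below -/
import Mathlib

section
/- Let n be a natural number and g : Fin n → A4 a tuple of elements of the alternating group A4 on four letters whose ordered product g 0 · g 1 ⋯ g (n−1) is the identity. Let a1 be the number of indices i such that g i is conjugate in A4 to the 3-cycle (0 1 2), and a2 the number of indices i such that g i is conjugate in A4 to the 3-cycle (0 2 1). Then a1 ≡ a2 (mod 3). -/
/-- The 3-cycle `(0 1 2)` in `S₄`. -/
def sigma1 : Equiv.Perm (Fin 4) := Equiv.swap 0 1 * Equiv.swap 1 2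

/-- The 3-cycle `(0 2 1)` in `S₄`. -/
def sigma2 : Equiv.Perm (Fin 4) := Equiv.swap 0 2 * Equiv.swap 2 1

/-- `(0 1 2)` as an element of the alternating group `A₄`. -/
def s1 : ↥(alternatingGroup (Fin 4)) :=
  ⟨sigma1, Equiv.Perm.mem_alternatingGroup.mpr (by decide)⟩

/-- `(0 2 1)` as an element of the alternating group `A₄`. -/
def s2 : ↥(alternatingGroup (Fin 4)) :=
  ⟨sigma2, Equiv.Perm.mem_alternatingGroup.mpr (by decide)⟩

/-- A label in `ℤ/3ℤ` for the splitting of `{0, 1, 2, 3}` into two pairs, one of which is `{a, b}`: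
the element which is paired with `3`. -/
def pairingLabel (a b : Fin 4) : ZMod 3 :=
  if a = 3 then b.val else if b = 3 then a.val else -(a.val + b.val)

theorem pairingLabel_apply_apply (x : ↥(alternatingGroup (Fin 4))) {a b : Fin 4} (hab : a ≠ b) :
    pairingLabel (x.1 a) (x.1 b) = pairingLabel a b + pairingLabel (x.1 0) (x.1 3) := by
  revert x a b
  decide

/-- The character `A₄ → ℤ/3ℤ` given by the action on the three splittings of `{0, 1, 2, 3}` into
two pairs. -/
def pairingChar : ↥(alternatingGroup (Fin 4)) →* Multiplicative (ZMod 3) where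
  toFun x := Multiplicative.ofAdd (pairingLabel (x.1 0) (x.1 3))
  map_one' := rfl
  map_mul' x y := by
    rw [← ofAdd_add, add_comm, ← pairingLabel_apply_apply x (y.1.injective.ne (by decide))]
    rfl

theorem toAdd_pairingChar (x : ↥(alternatingGroup (Fin 4))) :
    (pairingChar x).toAdd =
      (if ∃ h, h * s1 * h⁻¹ = x then 1 else 0) - (if ∃ h, h * s2 * h⁻¹ = x then 1 else 0) := by
  revert x
  decide

theorem toAdd_pairingChar_prod_ofFn (n : ℕ) (g : Fin n → ↥(alternatingGroup (Fin 4))) :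
    (pairingChar (List.ofFn g).prod).toAdd =
      (Nat.card {i : Fin n // ∃ h, h * s1 * h⁻¹ = g i} : ZMod 3) -
        Nat.card {i : Fin n // ∃ h, h * s2 * h⁻¹ = g i} := by
  simp only [map_list_prod, List.map_ofFn, List.prod_ofFn, toAdd_prod, Function.comp_apply,
    toAdd_pairingChar, Finset.sum_sub_distrib, Finset.sum_boole, Nat.card_eq_fintype_card,
    Fintype.card_subtype]

/-- If a tuple of elements of `A₄` has trivial ordered product, then the number of
entries conjugate in `A₄` to the 3-cycle `(0 1 2)` is congruent mod 3 to the number of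
entries conjugate in `A₄` to the 3-cycle `(0 2 1)`. -/
theorem A4_monodromy_three_cycle_count_mod_three
    (n : ℕ) (g : Fin n → ↥(alternatingGroup (Fin 4)))
    (hprod : (List.ofFn g).prod = 1) :
    Nat.card {i : Fin n // ∃ h : ↥(alternatingGroup (Fin 4)), h * s1 * h⁻¹ = g i}
      ≡ Nat.card {i : Fin n // ∃ h : ↥(alternatingGroup (Fin 4)), h * s2 * h⁻¹ = g i}
      [MOD 3] := by
  rw [← ZMod.natCast_eq_natCast_iff, ← sub_eq_zero, ← toAdd_pairingChar_prod_ofFn, hprod, map_one,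
    toAdd_one]
end

section
/- With T_{ijk} : ℂ³ → ℂ as defined in the context, set g(1,2) = g(2,1) = 1/3, g(3,3) = 1/4, g(i,j) = 0 otherwise, and ĝ(1,2) = ĝ(2,1) = 3, ĝ(3,3) = 4, ĝ(k,l) = 0 otherwise. Then for all i,j,n,m ∈ {1,2,3} and every x ∈ ℂ³ at which cos(−(λ_a·x + c_a)/2) ≠ 0 for each of the eleven terms a, one has 12·g(i,j)·g(n,m) + Σ_{k,l ∈ {1,2,3}} T_{ijk}(x)·ĝ(k,l)·T_{lnm}(x) = 12·g(i,n)·g(j,m) + Σ_{k,l ∈ {1,2,3}} T_{ink}(x)·ĝ(k,l)·T_{ljm}(x). -/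
open Real Complex

/-- `ω = e^{2πi/3}`. -/
noncomputable def om : ℂ := Complex.exp (2 * Real.pi * Complex.I / 3)

/-- `ω̄`, the complex conjugate of `ω`. -/
noncomputable def omb : ℂ := (starRingEnd ℂ) om

/-- `√3` as a complex number. -/
noncomputable def s3 : ℂ := (Real.sqrt 3 : ℂ)

/-- The multiplicities `m_a` of the eleven terms of the `A₄` generating function. -/
def mlt : Fin 11 → ℚ := ![1, 2, 1, 2, 1, 2, 1, 1, 1, 4, 1/2]

/-- The coefficient vectors `λ_a ∈ ℂ³` of the eleven terms. -/
noncomputable def lam : Fin 11 → Fin 3 → ℂ :=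
  ![![1/s3, 1/s3, 1/2],
    ![1/s3, 1/s3, 0],
    ![om/s3, omb/s3, 1/2],
    ![om/s3, omb/s3, 0],
    ![omb/s3, om/s3, 1/2],
    ![omb/s3, om/s3, 0],
    ![1/s3, 1/s3, -1/2],
    ![om/s3, omb/s3, -1/2],
    ![omb/s3, om/s3, -1/2],
    ![0, 0, 1/2],
    ![0, 0, 1]]

/-- The constants `c_a` of the eleven terms. -/
noncomputable def cst : Fin 11 → ℝ :=
  ![-5 * Real.pi / 6, -Real.pi / 3, -5 * Real.pi / 6, -Real.pi / 3,
    -5 * Real.pi / 6, -Real.pi / 3, Real.pi / 6, Real.pi / 6, Real.pi / 6,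
    Real.pi / 2, 0]

/-- The third partial derivatives `T_{ijk}` of the explicit `A₄` generating function
`F_{A₄} = Σ_a m_a · h(λ_a·x + c_a)` with `h'''(u) = (1/2)·tan(−u/2)`. -/
noncomputable def TA (i j k : Fin 3) (x : Fin 3 → ℂ) : ℂ :=
  ∑ a : Fin 11, (mlt a : ℂ) * lam a i * lam a j * lam a k * (1/2) *
    Complex.tan (-((∑ t : Fin 3, lam a t * x t) + (cst a : ℂ)) / 2)

/-- The pairing `g` for `A₄`. -/
def gp : Fin 3 → Fin 3 → ℚ := ![![0, 1/3, 0], ![1/3, 0, 0], ![0, 0, 1/4]]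

/-- The inverse pairing `ĝ` for `A₄`. -/
def gh : Fin 3 → Fin 3 → ℚ := ![![0, 3, 0], ![3, 0, 0], ![0, 0, 4]]

/-- `ω` is a root of the third cyclotomic polynomial. -/
theorem om_sq_add_om_add_one : om ^ 2 + om + 1 = 0 := by
  have h : IsPrimitiveRoot om 3 := by
    simpa [om] using Complex.isPrimitiveRoot_exp 3 (by norm_num)
  have h' := h.geom_sum_eq_zero (by norm_num)
  simp only [Finset.sum_range_succ, Finset.sum_range_zero] at h'
  linear_combination h'

theorem omb_eq : omb = -1 - om := by
  have h1 : omb * om = 1 := by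
    have hn : ‖om‖ = 1 := by
      have : om = Complex.exp ((2 * Real.pi / 3 : ℝ) * Complex.I) := by
        rw [om]; congr 1; push_cast; ring
      rw [this, Complex.norm_exp_ofReal_mul_I]
    rw [omb, mul_comm, Complex.mul_conj, Complex.normSq_eq_norm_sq, hn]
    norm_num
  linear_combination (-om - 1) * h1 + omb * om_sq_add_om_add_one

theorem s3_sq : s3 ^ 2 = 3 := by
  rw [s3, ← Complex.ofReal_pow, Real.sq_sqrt (by norm_num)]
  norm_num

/-- The addition theorem for the tangent of three angles with sum `π / 2`. -/
theorem tan_mul_tan_cyclic_sum {α β γ : ℂ} (hα : Complex.cos α ≠ 0) (hβ : Complex.cos β ≠ 0)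
    (hγ : Complex.cos γ ≠ 0) (h : α + β + γ = Real.pi / 2) :
    Complex.tan α * Complex.tan β + Complex.tan β * Complex.tan γ
      + Complex.tan α * Complex.tan γ = 1 := by
  obtain rfl : γ = Real.pi / 2 - (α + β) := by linear_combination h
  rw [Complex.cos_pi_div_two_sub, Complex.sin_add] at hγ
  simp only [Complex.tan_eq_sin_div_cos, Complex.cos_pi_div_two_sub, Complex.sin_pi_div_two_sub,
    Complex.sin_add, Complex.cos_add]
  field_simp
  ring

/-- The sums `T_{ijk}` with the eleven tangents replaced by arbitrary values `τ a`. -/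
noncomputable def weightedSum (τ : Fin 11 → ℂ) (i j k : Fin 3) : ℂ :=
  ∑ a : Fin 11, (mlt a : ℂ) * lam a i * lam a j * lam a k * (1/2) * τ a

theorem weightedSum_swap_left (τ : Fin 11 → ℂ) (i j k : Fin 3) :
    weightedSum τ i j k = weightedSum τ j i k :=
  Finset.sum_congr rfl fun _ _ => by ring

theorem weightedSum_swap_right (τ : Fin 11 → ℂ) (i j k : Fin 3) :
    weightedSum τ i j k = weightedSum τ i k j :=
  Finset.sum_congr rfl fun _ _ => by ring

set_option maxHeartbeats 1600000 in
/-- For a totally symmetric tensor the WDVV equations reduce to six of them. -/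
theorem wdvv_of_symmetric {t : Fin 3 → Fin 3 → Fin 3 → ℂ}
    (hl : ∀ i j k, t i j k = t j i k) (hr : ∀ i j k, t i j k = t i k j)
    (h1212 : 3 * (t 0 0 0 * t 1 1 1 - t 0 0 1 * t 0 1 1)
      + 4 * (t 0 0 2 * t 1 1 2 - t 0 1 2 ^ 2) = 4 / 3)
    (h1213 : 3 * (t 0 0 0 * t 1 1 2 - t 0 0 2 * t 0 1 1)
      + 4 * (t 0 0 2 * t 1 2 2 - t 0 2 2 * t 0 1 2) = 0)
    (h2123 : 3 * (t 1 1 1 * t 0 0 2 - t 1 1 2 * t 0 0 1)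
      + 4 * (t 1 1 2 * t 0 2 2 - t 1 2 2 * t 0 1 2) = 0)
    (h1313 : 3 * (t 0 0 0 * t 1 2 2 + t 0 0 1 * t 0 2 2 - 2 * t 0 0 2 * t 0 1 2)
      + 4 * (t 0 0 2 * t 2 2 2 - t 0 2 2 ^ 2) = 0)
    (h2323 : 3 * (t 1 1 1 * t 0 2 2 + t 0 1 1 * t 1 2 2 - 2 * t 1 1 2 * t 0 1 2)
      + 4 * (t 1 1 2 * t 2 2 2 - t 1 2 2 ^ 2) = 0)
    (h1323 : 3 * (t 0 0 1 * t 1 2 2 + t 0 1 1 * t 0 2 2 - t 0 0 2 * t 1 1 2 - t 0 1 2 ^ 2)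
      + 4 * (t 0 1 2 * t 2 2 2 - t 0 2 2 * t 1 2 2) = -1)
    (i j n m : Fin 3) :
    12 * (gp i j : ℂ) * (gp n m : ℂ) + ∑ k : Fin 3, ∑ l : Fin 3, t i j k * (gh k l : ℂ) * t l n m
    = 12 * (gp i n : ℂ) * (gp j m : ℂ)
      + ∑ k : Fin 3, ∑ l : Fin 3, t i n k * (gh k l : ℂ) * t l j m := by
  have e010 : t 0 1 0 = t 0 0 1 := hr _ _ _
  have e100 : t 1 0 0 = t 0 0 1 := (hl _ _ _).trans e010
  have e101 : t 1 0 1 = t 0 1 1 := hl _ _ _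
  have e110 : t 1 1 0 = t 0 1 1 := (hr _ _ _).trans e101
  have e020 : t 0 2 0 = t 0 0 2 := hr _ _ _
  have e200 : t 2 0 0 = t 0 0 2 := (hl _ _ _).trans e020
  have e202 : t 2 0 2 = t 0 2 2 := hl _ _ _
  have e220 : t 2 2 0 = t 0 2 2 := (hr _ _ _).trans e202
  have e121 : t 1 2 1 = t 1 1 2 := hr _ _ _
  have e211 : t 2 1 1 = t 1 1 2 := (hl _ _ _).trans e121
  have e212 : t 2 1 2 = t 1 2 2 := hl _ _ _
  have e221 : t 2 2 1 = t 1 2 2 := (hr _ _ _).trans e212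
  have e021 : t 0 2 1 = t 0 1 2 := hr _ _ _
  have e102 : t 1 0 2 = t 0 1 2 := hl _ _ _
  have e120 : t 1 2 0 = t 0 1 2 := (hr _ _ _).trans e102
  have e201 : t 2 0 1 = t 0 1 2 := (hl _ _ _).trans e021
  have e210 : t 2 1 0 = t 0 1 2 := (hl _ _ _).trans e120
  fin_cases i <;> fin_cases j <;> fin_cases n <;> fin_cases m <;>
    simp [gp, gh, Fin.sum_univ_three, e010, e100, e101, e110, e020, e200, e202, e220, e121, e211,
      e212, e221, e021, e102, e120, e201, e210] <;>
    first
    | done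
    | ring1
    | linear_combination h1212
    | linear_combination -h1212
    | linear_combination h1213
    | linear_combination -h1213
    | linear_combination h2123
    | linear_combination -h2123
    | linear_combination h1313
    | linear_combination -h1313
    | linear_combination h2323
    | linear_combination -h2323
    | linear_combination h1323
    | linear_combination -h1323

/-- WDVV for a tensor `t` whose components are discrete Fourier transforms over the cube roots of
unity of vectors `P`, `Q`, `R` satisfying rational quadratic relations. -/
theorem wdvv_of_fourier {t : Fin 3 → Fin 3 → Fin 3 → ℂ}
    (hl : ∀ i j k, t i j k = t j i k) (hr : ∀ i j k, t i j k = t i k j)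
    {w v q S P₀ P₁ P₂ Q₀ Q₁ Q₂ R₀ R₁ R₂ : ℂ}
    (hw : w ^ 2 + w + 1 = 0) (hv : v = -1 - w) (hq : 3 * q ^ 2 = 1)
    (t000 : t 0 0 0 = q / 3 * (P₀ + P₁ + P₂))
    (t111 : t 1 1 1 = q / 3 * (P₀ + P₁ + P₂))
    (t001 : t 0 0 1 = q / 3 * (P₀ + w * P₁ + v * P₂))
    (t011 : t 0 1 1 = q / 3 * (P₀ + v * P₁ + w * P₂))
    (t002 : t 0 0 2 = (Q₀ + v * Q₁ + w * Q₂) / 3)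
    (t012 : t 0 1 2 = (Q₀ + Q₁ + Q₂) / 3)
    (t112 : t 1 1 2 = (Q₀ + w * Q₁ + v * Q₂) / 3)
    (t022 : t 0 2 2 = q * (R₀ + w * R₁ + v * R₂))
    (t122 : t 1 2 2 = q * (R₀ + v * R₁ + w * R₂))
    (t222 : t 2 2 2 = S)
    (hPQ : P₀ * P₁ + P₁ * P₂ + P₂ * P₀ - 4 * (Q₀ * Q₁ + Q₁ * Q₂ + Q₂ * Q₀) = 4)
    (hX₀ : (P₁ + P₂) * Q₀ - P₁ * Q₂ - P₂ * Q₁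
      + 4 * (Q₁ * R₂ + Q₂ * R₁ - R₀ * (Q₁ + Q₂)) = 0)
    (hX₁ : (P₂ + P₀) * Q₁ - P₂ * Q₀ - P₀ * Q₂
      + 4 * (Q₂ * R₀ + Q₀ * R₂ - R₁ * (Q₂ + Q₀)) = 0)
    (hX₂ : (P₀ + P₁) * Q₂ - P₀ * Q₁ - P₁ * Q₀
      + 4 * (Q₀ * R₁ + Q₁ * R₀ - R₂ * (Q₀ + Q₁)) = 0)
    (hY₀ : 2 * P₀ * R₀ + (P₁ + P₂) * R₀ + P₁ * R₂ + P₂ * R₁ + 4 * Q₀ * S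
      - 2 * Q₀ * (Q₀ + Q₁ + Q₂) - 4 * R₀ ^ 2 - 8 * R₁ * R₂ = -1 / 4)
    (hY₁ : 2 * P₁ * R₁ + (P₂ + P₀) * R₁ + P₂ * R₀ + P₀ * R₂ + 4 * Q₁ * S
      - 2 * Q₁ * (Q₀ + Q₁ + Q₂) - 4 * R₁ ^ 2 - 8 * R₂ * R₀ = -1 / 4)
    (hY₂ : 2 * P₂ * R₂ + (P₀ + P₁) * R₂ + P₀ * R₁ + P₁ * R₀ + 4 * Q₂ * S
      - 2 * Q₂ * (Q₀ + Q₁ + Q₂) - 4 * R₂ ^ 2 - 8 * R₀ * R₁ = -1 / 4)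
    (hZ : P₀ * (2 * R₀ - R₁ - R₂) + P₁ * (2 * R₁ - R₂ - R₀) + P₂ * (2 * R₂ - R₀ - R₁)
      + 4 * (Q₀ + Q₁ + Q₂) * S - 2 * (Q₀ ^ 2 + Q₁ ^ 2 + Q₂ ^ 2)
      - (Q₀ * Q₁ + Q₁ * Q₂ + Q₂ * Q₀) - 4 * (R₀ ^ 2 + R₁ ^ 2 + R₂ ^ 2)
      + 4 * (R₀ * R₁ + R₁ * R₂ + R₂ * R₀) = -3)
    (i j n m : Fin 3) :
    12 * (gp i j : ℂ) * (gp n m : ℂ) + ∑ k : Fin 3, ∑ l : Fin 3, t i j k * (gh k l : ℂ) * t l n m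
    = 12 * (gp i n : ℂ) * (gp j m : ℂ)
      + ∑ k : Fin 3, ∑ l : Fin 3, t i n k * (gh k l : ℂ) * t l j m := by
  subst hv
  have hqq : q ^ 2 = 1 / 3 := by linear_combination hq / 3
  apply wdvv_of_symmetric hl hr <;>
    simp only [t000, t111, t001, t011, t002, t012, t112, t022, t122, t222]
  · linear_combination hPQ / 3 +
      ((-3) * (1 / 3 * (P₁ - P₂)) * -(1 / 3 * (P₁ - P₂)) / 3 +
        4 * -((Q₁ - Q₂) / 3) * ((Q₁ - Q₂) / 3)) * hw +
      (3 * ((P₀ + P₁ + P₂) / 3) * ((P₀ + P₁ + P₂) / 3) - 3 * ((P₀ + w * P₁ +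
        (-1 - w) * P₂) / 3) * ((P₀ + (-1 - w) * P₁ + w * P₂) / 3)) * hqq
  · linear_combination q / 3 * (hX₀ + w * hX₁ + (-1 - w) * hX₂) +
      ((-3) * -((Q₁ - Q₂) / 3) * -(q / 3 * (P₁ - P₂)) +
        4 * -((Q₁ - Q₂) / 3) * -(q * (R₁ - R₂))) * hw
  · linear_combination q / 3 * (hX₀ + (-1 - w) * hX₁ + w * hX₂) +
      ((-3) * ((Q₁ - Q₂) / 3) * (q / 3 * (P₁ - P₂)) + 4 * ((Q₁ - Q₂) / 3) * (q * (R₁ - R₂))) * hw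
  · linear_combination (hY₀ + (-1 - w) * hY₁ + w * hY₂) / 3 +
      (3 * (1 / 3 * (P₁ - P₂)) * (R₁ - R₂) / 3 - 4 * (R₁ - R₂) * (R₁ - R₂) / 3) * hw +
      (3 * ((P₀ + P₁ + P₂) / 3) * (R₀ + (-1 - w) * R₁ + w * R₂) + 3 * ((P₀ + w * P₁ +
        (-1 - w) * P₂) / 3) * (R₀ + w * R₁ + (-1 - w) * R₂) - 4 * (R₀ + w * R₁ +
        (-1 - w) * R₂) * (R₀ + w * R₁ + (-1 - w) * R₂)) * hqq
  · linear_combination (hY₀ + w * hY₁ + (-1 - w) * hY₂) / 3 +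
      (3 * -(1 / 3 * (P₁ - P₂)) * -(R₁ - R₂) / 3 + (-4) * -(R₁ - R₂) * -(R₁ - R₂) / 3) * hw +
      (3 * ((P₀ + P₁ + P₂) / 3) * (R₀ + w * R₁ + (-1 - w) * R₂) + 3 * ((P₀ + (-1 - w) * P₁ +
        w * P₂) / 3) * (R₀ + (-1 - w) * R₁ + w * R₂) - 4 * (R₀ + (-1 - w) * R₁ +
        w * R₂) * (R₀ + (-1 - w) * R₁ + w * R₂)) * hqq
  · linear_combination hZ / 3 +
      (3 * (1 / 3 * (P₁ - P₂)) * -(R₁ - R₂) / 3 + 3 * -(1 / 3 * (P₁ - P₂)) * (R₁ - R₂) / 3 +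
        (-3) * -((Q₁ - Q₂) / 3) * ((Q₁ - Q₂) / 3) - 4 * (R₁ - R₂) * -(R₁ - R₂) / 3) * hw +
      (3 * ((P₀ + w * P₁ + (-1 - w) * P₂) / 3) * (R₀ + (-1 - w) * R₁ + w * R₂) + 3 * ((P₀ +
        (-1 - w) * P₁ + w * P₂) / 3) * (R₀ + w * R₁ + (-1 - w) * R₂) - 4 * (R₀ + w * R₁ +
        (-1 - w) * R₂) * (R₀ + (-1 - w) * R₁ + w * R₂)) * hqq

/-- WDVV for weighted sums of eleven values satisfying the quadratic relations of the tangents. -/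
theorem weightedSum_wdvv {τ : Fin 11 → ℂ} {a b c : Fin 3 → ℂ} {d e : ℂ}
    (hτ : τ = ![a 0, b 0, a 1, b 1, a 2, b 2, c 0, c 1, c 2, d, e])
    (hb : b 0 * b 1 + b 1 * b 2 + b 0 * b 2 = 1)
    (had : ∀ r, a r * b r + a r * d - b r * d = -1)
    (hcd : ∀ r, c r * b r - c r * d + b r * d = -1)
    (hac : ∀ r, a r * e - c r * e + a r * c r = -1)
    (h : ∀ r s u, r ≠ s → s ≠ u → u ≠ r → a r * c s + c s * b u + a r * b u = 1)
    (i j n m : Fin 3) :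
    12 * (gp i j : ℂ) * (gp n m : ℂ)
      + ∑ k : Fin 3, ∑ l : Fin 3, weightedSum τ i j k * (gh k l : ℂ) * weightedSum τ l n m
    = 12 * (gp i n : ℂ) * (gp j m : ℂ)
      + ∑ k : Fin 3, ∑ l : Fin 3, weightedSum τ i n k * (gh k l : ℂ) * weightedSum τ l j m := by
  have hq : 3 * s3⁻¹ ^ 2 = 1 := by
    rw [inv_pow, s3_sq]; norm_num
  have hw := om_sq_add_om_add_one
  have h012 := h 0 1 2 (by decide) (by decide) (by decide)
  have h021 := h 0 2 1 (by decide) (by decide) (by decide)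
  have h102 := h 1 0 2 (by decide) (by decide) (by decide)
  have h120 := h 1 2 0 (by decide) (by decide) (by decide)
  have h201 := h 2 0 1 (by decide) (by decide) (by decide)
  have h210 := h 2 1 0 (by decide) (by decide) (by decide)
  subst hτ
  refine wdvv_of_fourier (weightedSum_swap_left _) (weightedSum_swap_right _)
    (w := om) (v := omb) (q := s3⁻¹)
    (P₀ := (a 0 + 2 * b 0 + c 0) / 2) (P₁ := (a 1 + 2 * b 1 + c 1) / 2)
    (P₂ := (a 2 + 2 * b 2 + c 2) / 2)
    (Q₀ := (a 0 - c 0) / 4) (Q₁ := (a 1 - c 1) / 4) (Q₂ := (a 2 - c 2) / 4)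
    (R₀ := (a 0 + c 0) / 8) (R₁ := (a 1 + c 1) / 8) (R₂ := (a 2 + c 2) / 8)
    (S := (a 0 + a 1 + a 2 - c 0 - c 1 - c 2) / 16 + d / 4 + e / 4)
    hw omb_eq hq ?_ ?_ ?_ ?_ ?_ ?_ ?_ ?_ ?_ ?_ ?_ ?_ ?_ ?_ ?_ ?_ ?_ ?_ i j n m
  · simp [weightedSum, Fin.sum_univ_succ, lam, mlt, omb_eq, div_eq_mul_inv, -inv_pow]
    linear_combination s3⁻¹ / 3 * ((a 1 + 2 * b 1 + c 1) / 2 * (-1 + om) + (a 2 + 2 * b 2 +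
        c 2) / 2 * (-2 - om)) * hw +
      s3⁻¹ / 3 * ((a 0 + 2 * b 0 + c 0) / 2 + (a 1 + 2 * b 1 + c 1) / 2 * (om ^ 3) + (a 2 +
        2 * b 2 + c 2) / 2 * (-1 - 3 * om - 3 * om ^ 2 - om ^ 3)) * hq
  · simp [weightedSum, Fin.sum_univ_succ, lam, mlt, omb_eq, div_eq_mul_inv, -inv_pow]
    linear_combination s3⁻¹ / 3 * ((a 1 + 2 * b 1 + c 1) / 2 * (-2 - om) + (a 2 + 2 * b 2 +
        c 2) / 2 * (-1 + om)) * hw +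
      s3⁻¹ / 3 * ((a 0 + 2 * b 0 + c 0) / 2 + (a 1 + 2 * b 1 +
        c 1) / 2 * (-1 - 3 * om - 3 * om ^ 2 - om ^ 3) + (a 2 + 2 * b 2 +
        c 2) / 2 * (om ^ 3)) * hq
  · simp [weightedSum, Fin.sum_univ_succ, lam, mlt, omb_eq, div_eq_mul_inv, -inv_pow]
    linear_combination s3⁻¹ / 3 * ((a 1 + 2 * b 1 + c 1) / 2 * (-om) + (a 2 + 2 * b 2 +
        c 2) / 2 * (1 + om)) * hw +
      s3⁻¹ / 3 * ((a 0 + 2 * b 0 + c 0) / 2 + (a 1 + 2 * b 1 + c 1) / 2 * (-om ^ 2 - om ^ 3) +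
        (a 2 + 2 * b 2 + c 2) / 2 * (om + 2 * om ^ 2 + om ^ 3)) * hq
  · simp [weightedSum, Fin.sum_univ_succ, lam, mlt, omb_eq, div_eq_mul_inv, -inv_pow]
    linear_combination s3⁻¹ / 3 * ((a 1 + 2 * b 1 + c 1) / 2 * (1 + om) + (a 2 + 2 * b 2 +
        c 2) / 2 * (-om)) * hw +
      s3⁻¹ / 3 * ((a 0 + 2 * b 0 + c 0) / 2 + (a 1 + 2 * b 1 + c 1) / 2 * (om + 2 * om ^ 2 +
        om ^ 3) + (a 2 + 2 * b 2 + c 2) / 2 * (-om ^ 2 - om ^ 3)) * hq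
  · simp [weightedSum, Fin.sum_univ_succ, lam, mlt, omb_eq, div_eq_mul_inv, -inv_pow]
    linear_combination 1 / 3 * ((a 1 - c 1) / 4 + (a 2 - c 2) / 4) * hw +
      1 / 3 * ((a 0 - c 0) / 4 + (a 1 - c 1) / 4 * (om ^ 2) + (a 2 - c 2) / 4 * (1 + 2 * om +
        om ^ 2)) * hq
  · simp [weightedSum, Fin.sum_univ_succ, lam, mlt, omb_eq, div_eq_mul_inv, -inv_pow]
    linear_combination 1 / 3 * ((a 1 - c 1) / 4 * (-1) + (a 2 - c 2) / 4 * (-1)) * hw +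
      1 / 3 * ((a 0 - c 0) / 4 + (a 1 - c 1) / 4 * (-om - om ^ 2) +
        (a 2 - c 2) / 4 * (-om - om ^ 2)) * hq
  · simp [weightedSum, Fin.sum_univ_succ, lam, mlt, omb_eq, div_eq_mul_inv, -inv_pow]
    linear_combination 1 / 3 * ((a 1 - c 1) / 4 + (a 2 - c 2) / 4) * hw +
      1 / 3 * ((a 0 - c 0) / 4 + (a 1 - c 1) / 4 * (1 + 2 * om + om ^ 2) +
        (a 2 - c 2) / 4 * (om ^ 2)) * hq
  · simp [weightedSum, Fin.sum_univ_succ, lam, mlt, omb_eq, div_eq_mul_inv, -inv_pow]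
    ring
  · simp [weightedSum, Fin.sum_univ_succ, lam, mlt, omb_eq, div_eq_mul_inv, -inv_pow]
    ring
  · simp [weightedSum, Fin.sum_univ_succ, lam, mlt]
    ring
  · linear_combination hb + (h012 + h021 + h102 + h120 + h201 + h210) / 2
  · linear_combination (h012 + h021 - h102 - h201) / 4
  · linear_combination (h102 + h120 - h012 - h210) / 4
  · linear_combination (h201 + h210 - h021 - h120) / 4
  · linear_combination (had 0 + hcd 0 + hac 0) / 4 + (h012 + h021 + h102 + h201) / 8
  · linear_combination (had 1 + hcd 1 + hac 1) / 4 + (h012 + h102 + h120 + h210) / 8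
  · linear_combination (had 2 + hcd 2 + hac 2) / 4 + (h021 + h120 + h201 + h210) / 8
  · linear_combination (had 0 + hcd 0 + hac 0 + had 1 + hcd 1 + hac 1 + had 2 + hcd 2 + hac 2) / 4
      - (h012 + h021 + h102 + h120 + h201 + h210) / 8

/-- The explicit `A₄` generating function satisfies the WDVV equations. -/
theorem A4_explicit_formula_satisfies_WDVV
    (i j n m : Fin 3) (x : Fin 3 → ℂ)
    (hcos : ∀ a : Fin 11,
      Complex.cos (-((∑ t : Fin 3, lam a t * x t) + (cst a : ℂ)) / 2) ≠ 0) :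
    12 * (gp i j : ℂ) * (gp n m : ℂ)
      + ∑ k : Fin 3, ∑ l : Fin 3, TA i j k x * (gh k l : ℂ) * TA l n m x
    = 12 * (gp i n : ℂ) * (gp j m : ℂ)
      + ∑ k : Fin 3, ∑ l : Fin 3, TA i n k x * (gh k l : ℂ) * TA l j m x := by
  set θ : Fin 11 → ℂ := fun a => -((∑ t : Fin 3, lam a t * x t) + (cst a : ℂ)) / 2
  let α : Fin 3 → Fin 11 := ![0, 2, 4]
  let β : Fin 3 → Fin 11 := ![1, 3, 5]
  let γ : Fin 3 → Fin 11 := ![6, 7, 8]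
  have hcos' : ∀ a, Complex.cos (-θ a) ≠ 0 := fun a => by
    rw [Complex.cos_neg]; exact hcos a
  refine weightedSum_wdvv (τ := fun a => Complex.tan (θ a))
    (a := fun r => Complex.tan (θ (α r))) (b := fun r => Complex.tan (θ (β r)))
    (c := fun r => Complex.tan (θ (γ r))) (d := Complex.tan (θ 9)) (e := Complex.tan (θ 10))
    ?_ ?_ ?_ ?_ ?_ ?_ i j n m
  · ext a
    fin_cases a <;> rfl
  · refine tan_mul_tan_cyclic_sum (hcos _) (hcos _) (hcos _) ?_
    simp [θ, β, lam, cst, Fin.sum_univ_three, omb_eq]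
    ring
  · intro r
    have h := tan_mul_tan_cyclic_sum (hcos (α r)) (hcos' (β r)) (hcos' 9) (by
      fin_cases r <;> simp [θ, α, β, lam, cst, Fin.sum_univ_three] <;> ring)
    simp only [Complex.tan_neg] at h
    linear_combination -h
  · intro r
    have h := tan_mul_tan_cyclic_sum (hcos' (γ r)) (hcos (β r)) (hcos' 9) (by
      fin_cases r <;> simp [θ, γ, β, lam, cst, Fin.sum_univ_three] <;> ring)
    simp only [Complex.tan_neg] at h
    linear_combination -h
  · intro r
    have h := tan_mul_tan_cyclic_sum (hcos (α r)) (hcos' (γ r)) (hcos' 10) (by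
      fin_cases r <;> simp [θ, γ, α, lam, cst, Fin.sum_univ_three] <;> ring)
    simp only [Complex.tan_neg] at h
    linear_combination -h
  · intro r s u hrs hsu hur
    refine tan_mul_tan_cyclic_sum (hcos _) (hcos _) (hcos _) ?_
    fin_cases r <;> fin_cases s <;> fin_cases u <;> simp at hrs hsu hur <;>
      simp [θ, α, β, γ, lam, cst, Fin.sum_univ_three, omb_eq] <;> ring
end
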